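/- Let P ∈ ℝ[x,y] be irreducible of degree d, let Γ = {(x,y) ∈ ℝ² : P(x,y) = 0} and assume Γ is infinite. Let k be an integer with 1 ≤ k < d. Then for every j = 1,…,μ, the j-th partial ξ-Wronskian W_j does not vanish identically on Γ; that is, there exists a point p ∈ Γ with W_j(p) ≠ 0. -/

import Mathlib

/-- Evaluation of a polynomial in two variables at a point of `ℝ²`. -/
noncomputable def evalRR (Q : MvPolynomial (Fin 2) ℝ) (p : ℝ × ℝ) : ℝ :=
  MvPolynomial.eval ![p.1, p.2] Q

/-- The derivation `L = L_P = P_y ∂/∂x - P_x ∂/∂y` applied to `Q`. -/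
noncomputable def Lop (P Q : MvPolynomial (Fin 2) ℝ) : MvPolynomial (Fin 2) ℝ :=
  MvPolynomial.pderiv 1 P * MvPolynomial.pderiv 0 Q -
    MvPolynomial.pderiv 0 P * MvPolynomial.pderiv 1 Q

/-- `f : Fin μ → ℝ[x,y]` is an enumeration of the monomials `x^a y^b` with `a + b ≤ k`. -/
def IsMonomialEnum (k : ℕ) {μ : ℕ} (f : Fin μ → MvPolynomial (Fin 2) ℝ) : Prop :=
  Function.Injective f ∧
    Set.range f =
      {q | ∃ a b : ℕ, a + b ≤ k ∧ q = MvPolynomial.X 0 ^ a * MvPolynomial.X 1 ^ b}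

/-- The `j`-th partial `ξ`-Wronskian: the determinant of the `j × j` matrix with
`(i, m)` entry `L^{i-1} f_m` (with `0`-based indexing, `L^i f_m`). -/
noncomputable def xiWronskian (P : MvPolynomial (Fin 2) ℝ) {μ : ℕ}
    (f : Fin μ → MvPolynomial (Fin 2) ℝ) (j : ℕ) (hj : j ≤ μ) : MvPolynomial (Fin 2) ℝ :=
  Matrix.det (Matrix.of fun i m : Fin j => (Lop P)^[(i : ℕ)] (f (Fin.castLE hj m)))

namespace XiW
open MvPolynomial

abbrev R2 := MvPolynomial (Fin 2) ℝ

lemma Lop_add (P a b : R2) : Lop P (a + b) = Lop P a + Lop P b := by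
  simp only [Lop, map_add]; ring

lemma Lop_mul (P a b : R2) : Lop P (a * b) = a * Lop P b + b * Lop P a := by
  simp only [Lop, Derivation.leibniz, smul_eq_mul]; ring

lemma Lop_self (P : R2) : Lop P P = 0 := by
  simp only [Lop]; ring

lemma Lop_C (P : R2) (r : ℝ) : Lop P (C r) = 0 := by
  simp [Lop]

lemma Lop_X0 (P : R2) : Lop P (X 0) = pderiv 1 P := by
  simp [Lop, pderiv_X]

lemma Lop_X1 (P : R2) : Lop P (X 1) = - pderiv 0 P := by
  simp [Lop, pderiv_X]

/-- Extension of the derivation to the fraction field. -/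
lemma exists_der (P : R2) {A K : Type} [CommRing A] [IsDomain A] [Field K] [Algebra ℝ K]
    [Algebra A K] [IsFractionRing A K] (ι : R2 →ₐ[ℝ] K) (q : R2 →+* A)
    (hq : Function.Surjective q) (hιeq : ∀ Q, ι Q = algebraMap A K (q Q))
    (hker : ∀ Q, q Q = 0 ↔ P ∣ Q) :
    ∃ D : Derivation ℝ K K, ∀ Q, D (ι Q) = ι (Lop P Q) := by
  let φ : R2 →+* DualNumber K :=
    { toFun := fun Q => TrivSqZeroExt.inl (ι Q) + TrivSqZeroExt.inr (ι (Lop P Q))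
      map_one' := by
        have : Lop P (1 : R2) = 0 := by simpa using Lop_C P 1
        ext <;> simp [this]
      map_zero' := by
        have : Lop P (0 : R2) = 0 := by simpa using Lop_C P 0
        ext <;> simp [this]
      map_mul' := by
        intro a b
        ext <;> simp [Lop_mul]
        ring
      map_add' := by
        intro a b
        ext <;> simp [Lop_add] }
  have hφP : φ P = 0 := by
    have h1 : ι P = 0 := by rw [hιeq, (hker P).2 dvd_rfl, map_zero]
    ext <;> simp [φ, h1, Lop_self]
  let φ₁ : A →+* DualNumber K := RingHom.liftOfSurjective q hq ⟨φ, (by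
    intro a ha
    obtain ⟨b, rfl⟩ := (hker a).1 ha
    rw [RingHom.mem_ker, map_mul, hφP, zero_mul])⟩
  have hφ₁ : ∀ Q, φ₁ (q Q) = φ Q := by
    intro Q
    simp only [φ₁]
    exact RingHom.liftOfRightInverse_comp_apply _ _ _ _ _
  have hu : ∀ y : nonZeroDivisors A, IsUnit (φ₁ y) := by
    rintro ⟨y, hy⟩
    rw [TrivSqZeroExt.isUnit_iff_isUnit_fst]
    obtain ⟨Q, rfl⟩ := hq y
    have : (φ₁ (q Q)).fst = algebraMap A K (q Q) := by
      rw [hφ₁, ← hιeq]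
      simp [φ]
    simp only [this]
    rw [isUnit_iff_ne_zero, Ne, FaithfulSMul.algebraMap_eq_zero_iff]
    exact nonZeroDivisors.ne_zero hy
  let φ₂ : K →+* DualNumber K := IsLocalization.lift (M := nonZeroDivisors A) hu
  have hφ₂ : ∀ Q, φ₂ (ι Q) = φ Q := by
    intro Q
    rw [hιeq]
    simp only [φ₂, IsLocalization.lift_eq, hφ₁]
  have hfst : ∀ c, (φ₂ c).fst = c := by
    intro c
    have : ((TrivSqZeroExt.fstHom ℝ K K).toRingHom.comp φ₂) = RingHom.id K := by
      apply IsLocalization.ringHom_ext (nonZeroDivisors A)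
      refine RingHom.ext fun y => ?_
      obtain ⟨Q, rfl⟩ := hq y
      change (φ₂ (algebraMap A K (q Q))).fst = algebraMap A K (q Q)
      rw [← hιeq, hφ₂]
      simp [φ]
    exact congrArg (fun f : K →+* K => f c) this
  let Dl : K →ₗ[ℝ] K :=
    { toFun := fun c => (φ₂ c).snd
      map_add' := by intro a b; simp
      map_smul' := by
        intro r c
        have : algebraMap ℝ K r = ι (C r) := by
          rw [← MvPolynomial.algebraMap_eq, AlgHom.commutes]
        rw [Algebra.smul_def, map_mul, TrivSqZeroExt.snd_mul, hfst, hfst, this, hφ₂]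
        simp [φ, Lop_C, Algebra.smul_def] }
  refine ⟨Derivation.mk' Dl ?_, ?_⟩
  · intro a b
    change (φ₂ (a * b)).snd = a • (φ₂ b).snd + b • (φ₂ a).snd
    rw [map_mul, TrivSqZeroExt.snd_mul, hfst, hfst]
    simp [mul_comm]
  · intro Q
    change (φ₂ (ι Q)).snd = _
    rw [hφ₂]
    simp [φ]

/-- Existence of the function field with its derivation. -/
lemma exists_field (P : R2) (hP : Irreducible P) :
    ∃ (K : Type) (_ : Field K) (_ : Algebra ℝ K) (ι : R2 →ₐ[ℝ] K) (D : Derivation ℝ K K),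
      (∀ Q, ι Q = 0 ↔ P ∣ Q) ∧ (∀ c : K, ∃ g h, ι h ≠ 0 ∧ c = ι g / ι h) ∧
      (∀ Q, D (ι Q) = ι (Lop P Q)) := by
  have hprime : (Ideal.span {P} : Ideal R2).IsPrime :=
    (Ideal.span_singleton_prime hP.ne_zero).2 hP.prime
  let A := R2 ⧸ (Ideal.span {P} : Ideal R2)
  let K := FractionRing A
  let ι : R2 →ₐ[ℝ] K := (IsScalarTower.toAlgHom ℝ A K).comp (Ideal.Quotient.mkₐ ℝ _)
  have hιeq : ∀ Q, ι Q = algebraMap A K (Ideal.Quotient.mk _ Q) := fun _ => rfl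
  have hker : ∀ Q, (Ideal.Quotient.mk (Ideal.span {P}) Q) = 0 ↔ P ∣ Q := by
    intro Q
    rw [Ideal.Quotient.eq_zero_iff_mem, Ideal.mem_span_singleton]
  have hι : ∀ Q, ι Q = 0 ↔ P ∣ Q := by
    intro Q
    rw [hιeq, FaithfulSMul.algebraMap_eq_zero_iff, hker]
  have hsurj : ∀ c : K, ∃ g h, ι h ≠ 0 ∧ c = ι g / ι h := by
    intro c
    obtain ⟨a, b, hb, rfl⟩ := IsFractionRing.div_surjective (A := A) c
    obtain ⟨g, rfl⟩ := Ideal.Quotient.mk_surjective a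
    obtain ⟨h, rfl⟩ := Ideal.Quotient.mk_surjective b
    refine ⟨g, h, ?_, by rw [hιeq, hιeq]⟩
    rw [hιeq, Ne, FaithfulSMul.algebraMap_eq_zero_iff]
    exact nonZeroDivisors.ne_zero hb
  obtain ⟨D, hD⟩ := exists_der P ι (Ideal.Quotient.mk _) Ideal.Quotient.mk_surjective hιeq hker
  exact ⟨K, inferInstance, inferInstance, ι, D, hι, hsurj, hD⟩

/-- Two elements of the function field are algebraically dependent. -/
lemma alg_dep (P : R2) (hP : Irreducible P) {K : Type} [Field K] [Algebra ℝ K] (ι : R2 →ₐ[ℝ] K)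
    (hι : ∀ Q, ι Q = 0 ↔ P ∣ Q) (hs : ∀ c : K, ∃ g h, ι h ≠ 0 ∧ c = ι g / ι h) (a b : K) :
    ∃ F : Polynomial (Polynomial ℝ), F ≠ 0 ∧
      F.eval₂ (Polynomial.aeval (R := ℝ) a).toRingHom b = 0 := by
  have hnot : ¬ AlgebraicIndependent ℝ ![a, b] := by
    intro hab
    let x : Fin 2 → K := fun i => ι (X i)
    have hx : ∀ Q, aeval x Q = ι Q := by
      intro Q
      have : aeval x = ι := by ext i; simp [x]
      rw [this]
    have hle := hab.cardinalMk_le_trdeg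
    have : Algebra.IsAlgebraic (Algebra.adjoin ℝ (Set.range x)) K := by
      have hmem : ∀ Q, ι Q ∈ Algebra.adjoin ℝ (Set.range x) := by
        intro Q
        rw [← hx, Algebra.adjoin_range_eq_range_aeval]
        exact ⟨Q, rfl⟩
      constructor
      intro c
      obtain ⟨g, h, hh, rfl⟩ := hs c
      rw [div_eq_mul_inv]
      refine IsAlgebraic.mul ?_ (IsAlgebraic.inv ?_)
      · exact isAlgebraic_algebraMap (⟨ι g, hmem g⟩ : Algebra.adjoin ℝ (Set.range x))
      · exact isAlgebraic_algebraMap (⟨ι h, hmem h⟩ : Algebra.adjoin ℝ (Set.range x))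
    have hb := Algebra.IsAlgebraic.isTranscendenceBasis_of_le_trdeg_of_finite (R := ℝ) x (by simpa using hle)
    have hi := hb.1
    rw [algebraicIndependent_iff] at hi
    exact hP.ne_zero (hi P (by rw [hx, hι]))
  rw [algebraicIndependent_iff] at hnot
  push Not at hnot
  obtain ⟨p, hp, hp0⟩ := hnot
  refine ⟨(Polynomial.Bivariate.equivMvPolynomial ℝ).symm p, by simpa using hp0, ?_⟩
  rw [← hp]
  have key : ∀ F : Polynomial (Polynomial ℝ),
      F.eval₂ (Polynomial.aeval (R := ℝ) a).toRingHom b =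
        aeval ![a, b] (Polynomial.Bivariate.equivMvPolynomial ℝ F) := by
    intro F
    induction F using Polynomial.induction_on' with
    | add p q hp hq => simp only [Polynomial.eval₂_add, map_add, hp, hq]
    | monomial n q =>
      induction q using Polynomial.induction_on' with
      | add p q hp hq =>
        simp only [map_add, Polynomial.eval₂_add, hp, hq]
      | monomial m r =>
        rw [← Polynomial.C_mul_X_pow_eq_monomial, ← Polynomial.C_mul_X_pow_eq_monomial]
        simp only [Polynomial.eval₂_mul, Polynomial.eval₂_C, Polynomial.eval₂_pow,
          Polynomial.eval₂_X, map_mul,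
          map_pow, Polynomial.Bivariate.equivMvPolynomial_C_C,
          Polynomial.Bivariate.equivMvPolynomial_C_X, Polynomial.Bivariate.equivMvPolynomial_X,
          aeval_X, aeval_C]
        simp
  rw [key, AlgEquiv.apply_symm_apply]

/-- A polynomial with constant coefficients having a non-constant root is zero. -/
lemma const_poly_zero {K : Type} [Field K] [Algebra ℝ K] (D : Derivation ℝ K K) (z : K)
    (hz : D z ≠ 0) : ∀ n : ℕ, ∀ p : Polynomial K, p.natDegree ≤ n → (∀ i, D (p.coeff i) = 0) →
      p.eval z = 0 → p = 0 := by
  have : CharZero K := charZero_of_injective_algebraMap (algebraMap ℝ K).injective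
  have hder : ∀ p : Polynomial K, (∀ i, D (p.coeff i) = 0) →
      D (p.eval z) = p.derivative.eval z * D z := by
    intro p hp
    rw [Polynomial.eval_eq_sum_range, Polynomial.derivative_eval, Polynomial.sum_over_range]
    · rw [map_sum, Finset.sum_mul]
      refine Finset.sum_congr rfl fun i _ => ?_
      simp [hp, Derivation.leibniz_pow]
      ring
    · simp
  intro n
  induction n with
  | zero =>
    intro p hn _ h0
    rw [Polynomial.eq_C_of_natDegree_le_zero hn] at h0 ⊢
    simpa using h0
  | succ n ih =>
    intro p hn hp h0
    have h1 := hder p hp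
    rw [h0, map_zero] at h1
    have h2 : p.derivative.eval z = 0 := by
      rcases mul_eq_zero.1 h1.symm with h | h
      · exact h
      · exact absurd h hz
    have h3 := ih p.derivative (by
      have := Polynomial.natDegree_derivative_le p
      omega) (by
      intro i
      rw [Polynomial.coeff_derivative, D.leibniz, hp]
      have : D ((i : K) + 1) = 0 := by
        rw [map_add, D.map_natCast, D.map_one_eq_zero, add_zero]
      simp [this]) h2
    have h4 := Polynomial.derivative_eq_zero.1 h3
    rw [Polynomial.eq_C_of_natDegree_eq_zero h4] at h0 ⊢
    simpa using h0

/-- Constants are algebraic. -/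
lemma const_alg (P : R2) (hP : Irreducible P) {K : Type} [Field K] [Algebra ℝ K] (ι : R2 →ₐ[ℝ] K)
    (D : Derivation ℝ K K)
    (hι : ∀ Q, ι Q = 0 ↔ P ∣ Q) (hs : ∀ c : K, ∃ g h, ι h ≠ 0 ∧ c = ι g / ι h)
    (z : K) (hz : D z ≠ 0) (c : K) (hc : D c = 0) :
    ∃ m : Polynomial ℝ, m ≠ 0 ∧ Polynomial.aeval c m = 0 := by
  obtain ⟨F, hF, h0⟩ := alg_dep P hP ι hι hs c z
  have hDc : ∀ m : Polynomial ℝ, D (Polynomial.aeval c m) = 0 := by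
    intro m
    rw [D.map_aeval, hc]
    simp
  have h1 := const_poly_zero D z hz _ (F.map (Polynomial.aeval (R := ℝ) c).toRingHom) le_rfl
    (by intro i; rw [Polynomial.coeff_map]; exact hDc _) (by rw [Polynomial.eval_map]; exact h0)
  refine ⟨F.leadingCoeff, by simpa using hF, ?_⟩
  have h2 := congrArg (fun q => Polynomial.coeff q F.natDegree) h1
  simp only [Polynomial.coeff_map, Polynomial.coeff_zero] at h2
  exact h2

/-- `D` is not identically zero. -/
lemma exists_nonconst (P : R2) (hP : Irreducible P) {K : Type} [Field K] [Algebra ℝ K]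
    (ι : R2 →ₐ[ℝ] K) (D : Derivation ℝ K K)
    (hι : ∀ Q, ι Q = 0 ↔ P ∣ Q) (hD : ∀ Q, D (ι Q) = ι (Lop P Q)) (hd : 1 ≤ P.totalDegree) :
    ∃ z : K, D z ≠ 0 := by
  by_contra! hcon
  have hdvd : ∀ i, P ∣ pderiv i P := by
    intro i
    fin_cases i
    · have := hcon (ι (X 1))
      rw [hD, hι, Lop_X1, dvd_neg] at this
      exact this
    · have := hcon (ι (X 0))
      rw [hD, hι, Lop_X0] at this
      exact this
  have hz : ∀ i, pderiv i P = 0 := by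
    intro i
    by_contra hne
    have h1 := totalDegree_le_of_dvd_of_isDomain (hdvd i) hne
    have h2 : (pderiv i P).totalDegree ≤ P.totalDegree - 1 := by
      refine Finset.sup_le fun m hm => ?_
      rw [mem_support_iff, coeff_pderiv] at hm
      have h3 : m + Finsupp.single i 1 ∈ P.support := by
        rw [mem_support_iff]
        exact left_ne_zero_of_mul hm
      have h4 := le_totalDegree h3
      rw [Finsupp.sum_add_index' (by simp) (by simp), Finsupp.sum_single_index (by rfl)] at h4
      omega
    omega
  have : P.totalDegree = 0 := by
    rw [totalDegree_eq_zero_iff_eq_C]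
    ext m
    classical
    rw [coeff_C]
    split_ifs with hm
    · rw [← hm]
    · obtain ⟨i, hi⟩ : ∃ i, m i ≠ 0 := by
        by_contra! h
        exact hm (by ext i; simp [h i])
      have h1 := congrArg (coeff (m - Finsupp.single i 1)) (hz i)
      rw [coeff_pderiv, tsub_add_cancel_of_le (by
        rw [Finsupp.single_le_iff]; omega), coeff_zero] at h1
      rcases mul_eq_zero.1 h1 with h | h
      · exact h
      · exfalso
        have : (0 : ℝ) < ((m - Finsupp.single i 1 : Fin 2 →₀ ℕ) i : ℝ) + 1 := by positivity
        exact this.ne' h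
  omega

/-- Weak Bezout. -/
lemma bezout (P : R2) (hP : Irreducible P) {K : Type} [Field K] [Algebra ℝ K]
    (ι : R2 →ₐ[ℝ] K)
    (hι : ∀ Q, ι Q = 0 ↔ P ∣ Q) (hs : ∀ c : K, ∃ g h, ι h ≠ 0 ∧ c = ι g / ι h)
    (Q : R2) (hQ : ¬ P ∣ Q) : {p : ℝ × ℝ | evalRR P p = 0 ∧ evalRR Q p = 0}.Finite := by
  have key : ∀ i : Fin 2, ∃ r : Polynomial ℝ, r ≠ 0 ∧ ∀ p : ℝ × ℝ, evalRR P p = 0 →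
      evalRR Q p = 0 → r.eval (![p.1, p.2] i) = 0 := by
    intro i
    obtain ⟨F, hF, h0⟩ := alg_dep P hP ι hι hs (ι (X i)) (ι Q)
    have hred : ∀ n : ℕ, ∀ F : Polynomial (Polynomial ℝ), F.natDegree ≤ n → F ≠ 0 →
        F.eval₂ (Polynomial.aeval (R := ℝ) (ι (X i))).toRingHom (ι Q) = 0 →
        ∃ G : Polynomial (Polynomial ℝ), G.coeff 0 ≠ 0 ∧
          G.eval₂ (Polynomial.aeval (R := ℝ) (ι (X i))).toRingHom (ι Q) = 0 := by
      intro n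
      induction n with
      | zero =>
        intro F hn hF h0
        refine ⟨F, ?_, h0⟩
        rw [Polynomial.eq_C_of_natDegree_le_zero hn] at hF
        simpa using hF
      | succ n ih =>
        intro F hn hF h0
        by_cases hc : F.coeff 0 = 0
        · have hFX : F = F.divX * Polynomial.X := by
            conv_lhs => rw [← Polynomial.divX_mul_X_add F, hc]
            simp
          refine ih F.divX ?_ ?_ ?_
          · rw [Polynomial.natDegree_divX_eq_natDegree_tsub_one]; omega
          · intro h; rw [h, zero_mul] at hFX; exact hF hFX
          · rw [hFX, Polynomial.eval₂_mul, Polynomial.eval₂_X] at h0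
            rcases mul_eq_zero.1 h0 with h | h
            · exact h
            · exact absurd ((hι Q).1 h) hQ
        · exact ⟨F, hc, h0⟩
    obtain ⟨G, hG, hG0⟩ := hred _ F le_rfl hF h0
    refine ⟨G.coeff 0, hG, ?_⟩
    intro p hp hq
    let T : R2 := G.eval₂ (Polynomial.aeval (R := ℝ) (X i : R2)).toRingHom Q
    have hT : P ∣ T := by
      rw [← hι, ← hG0]
      change ι.toRingHom _ = _
      rw [Polynomial.hom_eval₂]
      congr 1
      ext <;> simp
    obtain ⟨S, hS⟩ := hT
    have hTp : eval ![p.1, p.2] T = 0 := by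
      unfold evalRR at hp
      rw [hS, map_mul, hp, zero_mul]
    unfold evalRR at hq
    rw [Polynomial.hom_eval₂, hq, Polynomial.eval₂_at_zero] at hTp
    rw [← hTp]
    have : (Polynomial.evalRingHom (![p.1, p.2] i)) =
        (eval ![p.1, p.2]).comp (Polynomial.aeval (R := ℝ) (X i : R2)).toRingHom := by
      ext <;> simp
    exact congrArg (fun f : Polynomial ℝ →+* ℝ => f (G.coeff 0)) this
  obtain ⟨r, hr, hr0⟩ := key 0
  obtain ⟨s, hs, hs0⟩ := key 1
  refine Set.Finite.subset ((Polynomial.finite_setOfPred_isRoot hr).prod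
    (Polynomial.finite_setOfPred_isRoot hs)) ?_
  rintro p ⟨h1, h2⟩
  exact ⟨hr0 p h1 h2, hs0 p h1 h2⟩

/-- Constants are real. -/
lemma const_real (P : R2) (hP : Irreducible P) {K : Type} [Field K] [Algebra ℝ K]
    (ι : R2 →ₐ[ℝ] K) (D : Derivation ℝ K K)
    (hι : ∀ Q, ι Q = 0 ↔ P ∣ Q) (hs : ∀ c : K, ∃ g h, ι h ≠ 0 ∧ c = ι g / ι h)
    (z : K) (hz : D z ≠ 0) (hinf : {p | evalRR P p = 0}.Infinite) (c : K) (hc : D c = 0) :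
    ∃ r : ℝ, c = algebraMap ℝ K r := by
  obtain ⟨m, hm, hm0⟩ := const_alg P hP ι D hι hs z hz c hc
  obtain ⟨g, h, hh, rfl⟩ := hs c
  have hhom : ∀ {F : Type} [Field F] [Algebra ℝ F] (a b : F), b ≠ 0 →
      ∑ i ∈ Finset.range (m.natDegree + 1), algebraMap ℝ F (m.coeff i) * a ^ i *
        b ^ (m.natDegree - i) = b ^ m.natDegree * Polynomial.aeval (a / b) m := by
    intro F _ _ a b hb
    rw [Polynomial.aeval_eq_sum_range, Finset.mul_sum]
    refine Finset.sum_congr rfl fun i hi => ?_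
    have : i ≤ m.natDegree := by simpa [Nat.lt_succ_iff] using hi
    rw [Algebra.smul_def, div_pow, ← pow_sub_mul_pow b this]
    field_simp
  let T : R2 := ∑ i ∈ Finset.range (m.natDegree + 1), C (m.coeff i) * g ^ i * h ^ (m.natDegree - i)
  have hT : P ∣ T := by
    rw [← hι]
    simp only [T, map_sum, map_mul, map_pow]
    have : ∀ r, ι (C r) = algebraMap ℝ K r := by
      intro r; rw [← MvPolynomial.algebraMap_eq, AlgHom.commutes]
    simp only [this]
    rw [hhom _ _ hh, hm0, mul_zero]
  obtain ⟨S, hS⟩ := hT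
  have hroot : ∀ p, evalRR P p = 0 → evalRR h p ≠ 0 → m.eval (evalRR g p / evalRR h p) = 0 := by
    intro p hp hhp
    have h1 : evalRR T p = 0 := by
      unfold evalRR at hp ⊢
      rw [hS, map_mul, hp, zero_mul]
    have h2 := hhom (F := ℝ) (evalRR g p) (evalRR h p) hhp
    have h3 : evalRR T p = ∑ i ∈ Finset.range (m.natDegree + 1),
        algebraMap ℝ ℝ (m.coeff i) * (evalRR g p) ^ i * (evalRR h p) ^ (m.natDegree - i) := by
      simp [evalRR, T]
    rw [← h3, h1] at h2
    rcases mul_eq_zero.1 h2.symm with h | h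
    · exact absurd h (pow_ne_zero _ hhp)
    · simpa using h
  by_contra! hcon
  have hfin : ∀ r : ℝ, {p : ℝ × ℝ | evalRR P p = 0 ∧ evalRR (g - C r * h) p = 0}.Finite := by
    intro r
    apply bezout P hP ι hι hs
    rw [← hι, map_sub, map_mul, ← MvPolynomial.algebraMap_eq, AlgHom.commutes, sub_eq_zero]
    intro he
    exact hcon r (by rw [he, mul_div_cancel_right₀ _ hh])
  have hfin2 := bezout P hP ι hι hs h (fun hd => hh ((hι h).2 hd))
  refine hinf (((Polynomial.finite_setOfPred_isRoot hm).biUnion (fun r _ => hfin r)).union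
    hfin2 |>.subset ?_)
  intro p hp
  by_cases hhp : evalRR h p = 0
  · exact Or.inr ⟨hp, hhp⟩
  · left
    refine Set.mem_biUnion (hroot p hp hhp) ⟨hp, ?_⟩
    simp only [evalRR, map_sub, map_mul, eval_C] at hhp ⊢
    rw [div_mul_cancel₀ _ hhp, sub_self]

/-- Vanishing Wronskian implies linear dependence over the constants. -/
lemma wronskian_dep {K : Type} [Field K] [Algebra ℝ K] (D : Derivation ℝ K K) (n : ℕ)
    (f : Fin n → K) (hW : Matrix.det (Matrix.of fun i m : Fin n => (D)^[(i : ℕ)] (f m)) = 0) :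
    ∃ v : Fin n → K, v ≠ 0 ∧ (∀ m, D (v m) = 0) ∧ ∑ m, v m * f m = 0 := by
  classical
  let V : ℕ → Submodule K (Fin n → K) := fun i =>
    { carrier := {v | ∀ l < i, ∑ m, v m * D^[l] (f m) = 0}
      add_mem' := by
        intro a b ha hb l hl
        simp only [Pi.add_apply, add_mul, Finset.sum_add_distrib, ha l hl, hb l hl, add_zero]
      zero_mem' := by intro l _; simp
      smul_mem' := by
        intro c a ha l hl
        simp only [Pi.smul_apply, smul_eq_mul, mul_assoc, ← Finset.mul_sum, ha l hl, mul_zero] }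
  have hV : ∀ i v, v ∈ V i ↔ ∀ l < i, ∑ m, v m * D^[l] (f m) = 0 := fun _ _ => Iff.rfl
  have hanti : ∀ i, V (i + 1) ≤ V i := fun i v hv l hl => hv l (by omega)
  have hVn : V n ≠ ⊥ := by
    obtain ⟨v, hv0, hv⟩ := Matrix.exists_mulVec_eq_zero_iff.2 hW
    intro hbot
    apply hv0
    have : v ∈ V n := by
      intro l hl
      have := congrFun hv ⟨l, hl⟩
      simpa [Matrix.mulVec, dotProduct, mul_comm] using this
    rw [hbot] at this
    simpa using this
  have hex : ∃ i < n, V (i + 1) = V i := by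
    by_contra! hne
    have hdim : ∀ i ≤ n, Module.finrank K (V i) + i ≤ n := by
      intro i
      induction i with
      | zero =>
        intro _
        simpa using Submodule.finrank_le (V 0)
      | succ i ih =>
        intro hi
        have := Submodule.finrank_lt_finrank_of_lt (lt_of_le_of_ne (hanti i) (hne i (by omega)))
        have := ih (by omega)
        omega
    have := hdim n le_rfl
    exact hVn (Submodule.finrank_eq_zero.1 (by omega))
  obtain ⟨i, hi, hVi⟩ := hex
  have hstab : ∀ v ∈ V i, (fun m => D (v m)) ∈ V i := by
    intro v hv l hl
    rw [← hVi] at hv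
    have h1 := hv l (by omega)
    have h2 := hv (l + 1) (by omega)
    have h3 := congrArg D h1
    rw [map_sum, map_zero] at h3
    simp only [Derivation.leibniz, smul_eq_mul, Finset.sum_add_distrib] at h3
    simp only [Function.iterate_succ_apply'] at h2
    rw [h2, zero_add] at h3
    rw [← h3]
    exact Finset.sum_congr rfl fun _ _ => mul_comm _ _
  have hmono : ∀ a b, a ≤ b → V b ≤ V a := fun a b hab v hv l hl => hv l (by omega)
  have hVine : ∃ v ∈ V i, v ≠ 0 := by
    obtain ⟨v, hv, hv0⟩ := Submodule.exists_mem_ne_zero_of_ne_bot hVn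
    exact ⟨v, hmono i n hi.le hv, hv0⟩
  -- minimal support
  have hmin : ∀ N : ℕ, ∀ v ∈ V i, v ≠ 0 → (Finset.univ.filter fun m => v m ≠ 0).card ≤ N →
      ∃ w ∈ V i, w ≠ 0 ∧ ∀ m, D (w m) = 0 := by
    intro N
    induction N with
    | zero =>
      intro v _ hv0 hc
      exfalso
      apply hv0
      funext m
      by_contra hm
      have : m ∈ (Finset.univ.filter fun m => v m ≠ 0) := by simpa using hm
      rw [Finset.card_eq_zero.1 (Nat.le_zero.1 hc)] at this
      simp at this
    | succ N ih =>
      intro v hv hv0 hc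
      obtain ⟨m₀, hm₀⟩ := Function.ne_iff.1 hv0
      simp only [Pi.zero_apply] at hm₀
      let w : Fin n → K := (v m₀)⁻¹ • v
      have hw : w ∈ V i := (V i).smul_mem _ hv
      have hw1 : w m₀ = 1 := by simp [w, hm₀]
      have hw0 : w ≠ 0 := by
        intro h; rw [h] at hw1; simp at hw1
      by_cases hD : (fun m => D (w m)) = 0
      · exact ⟨w, hw, hw0, fun m => congrFun hD m⟩
      · refine ih _ (hstab w hw) hD ?_
        have : (Finset.univ.filter fun m => D (w m) ≠ 0) ⊂
            (Finset.univ.filter fun m => v m ≠ 0) := by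
          rw [Finset.ssubset_iff_of_subset]
          · exact ⟨m₀, by simpa using hm₀, by simp [hw1]⟩
          · intro m
            simp only [Finset.mem_filter, Finset.mem_univ, true_and]
            intro h1 h2
            apply h1
            simp [w, h2]
        have := Finset.card_lt_card this
        omega
  obtain ⟨v, hv, hv0⟩ := hVine
  obtain ⟨w, hw, hw0, hwD⟩ := hmin _ v hv hv0 le_rfl
  refine ⟨w, hw0, hwD, ?_⟩
  rw [← hVi] at hw
  exact hw 0 (by omega)

end XiW

theorem xiWronskian_not_identically_zero_on_curve
    (P : MvPolynomial (Fin 2) ℝ) (hP : Irreducible P)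
    (d : ℕ) (hd : d = P.totalDegree)
    (Γ : Set (ℝ × ℝ)) (hΓ : Γ = {p | evalRR P p = 0}) (hinf : Γ.Infinite)
    (k : ℕ) (hk1 : 1 ≤ k) (hkd : k < d)
    (μ : ℕ) (hμ : μ = (k + 1) * (k + 2) / 2)
    (f : Fin μ → MvPolynomial (Fin 2) ℝ) (hf : IsMonomialEnum k f) :
    ∀ j : ℕ, 1 ≤ j → ∀ hj : j ≤ μ,
      ∃ p ∈ Γ, evalRR (xiWronskian P f j hj) p ≠ 0 := by
  subst hd
  subst hΓ
  intro j hj1 hj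
  by_contra! hcon
  obtain ⟨K, _, _, ι, D, hι, hs, hD⟩ := XiW.exists_field P hP
  obtain ⟨z, hz⟩ := XiW.exists_nonconst P hP ι D hι hD (by omega)
  -- `P` divides the Wronskian
  have hPW : P ∣ xiWronskian P f j hj := by
    by_contra hndvd
    refine hinf ((XiW.bezout P hP ι hι hs _ hndvd).subset ?_)
    intro p hp
    exact ⟨hp, hcon p hp⟩
  have hit : ∀ (i : ℕ) Q, ι ((Lop P)^[i] Q) = D^[i] (ι Q) := by
    intro i Q
    induction i with
    | zero => rfl
    | succ i ih => rw [Function.iterate_succ_apply', Function.iterate_succ_apply', ← hD, ih]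
  have hW0 : Matrix.det (Matrix.of fun i m : Fin j =>
      (D)^[(i : ℕ)] (ι (f (Fin.castLE hj m)))) = 0 := by
    rw [← hι, xiWronskian, AlgHom.map_det] at hPW
    rw [← hPW]
    congr 1
    ext i m
    simp [hit]
  obtain ⟨v, hv0, hvD, hv⟩ := XiW.wronskian_dep D j (fun m => ι (f (Fin.castLE hj m))) hW0
  have hreal := fun m => XiW.const_real P hP ι D hι hs z hz hinf (v m) (hvD m)
  choose r hr using hreal
  let S : MvPolynomial (Fin 2) ℝ := ∑ m, MvPolynomial.C (r m) * f (Fin.castLE hj m)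
  have hPS : P ∣ S := by
    rw [← hι, ← hv]
    simp only [S, map_sum, map_mul]
    refine Finset.sum_congr rfl fun m _ => ?_
    rw [hr, ← MvPolynomial.algebraMap_eq, AlgHom.commutes]
  -- exponents
  have hexp : ∀ n, ∃ e : Fin 2 →₀ ℕ, (e.sum fun _ t => t) ≤ k ∧
      f n = MvPolynomial.monomial e 1 := by
    intro n
    have : f n ∈ Set.range f := ⟨n, rfl⟩
    rw [hf.2] at this
    obtain ⟨a, b, hab, h⟩ := this
    refine ⟨Finsupp.single 0 a + Finsupp.single 1 b, ?_, ?_⟩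
    · rw [Finsupp.sum_add_index' (by simp) (by simp), Finsupp.sum_single_index (by rfl),
        Finsupp.sum_single_index (by rfl)]
      exact hab
    · rw [h, MvPolynomial.X_pow_eq_monomial, MvPolynomial.X_pow_eq_monomial,
        MvPolynomial.monomial_mul, one_mul]
  choose e he hfe using hexp
  have hS0 : S = 0 := by
    by_contra hne
    have h1 := MvPolynomial.totalDegree_le_of_dvd_of_isDomain hPS hne
    have h2 : S.totalDegree ≤ k := by
      refine MvPolynomial.totalDegree_finsetSum_le fun m _ => ?_
      rw [hfe, MvPolynomial.C_mul_monomial]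
      exact (MvPolynomial.totalDegree_monomial_le _ _).trans (he _)
    omega
  apply hv0
  funext m
  have hc := congrArg (MvPolynomial.coeff (e (Fin.castLE hj m))) hS0
  simp only [S, MvPolynomial.coeff_sum, MvPolynomial.coeff_C_mul, MvPolynomial.coeff_zero] at hc
  rw [Finset.sum_eq_single m] at hc
  · rw [hfe, MvPolynomial.coeff_monomial, if_pos rfl, mul_one] at hc
    rw [hr, hc]
    simp
  · intro m' _ hne
    rw [hfe, MvPolynomial.coeff_monomial, if_neg, mul_zero]
    intro heq
    have h1 : f (Fin.castLE hj m') = f (Fin.castLE hj m) := by rw [hfe, hfe, heq]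
    exact hne (Fin.castLE_injective hj (hf.1 h1))
  · intro h
    exact absurd (Finset.mem_univ m) h
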